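/- Let R ≅ R1 × R2 × ⋯ × Rn with n ≥ 3, where each Ri is a local commutative ring with unity and maximal ideal Mi. Then the four pairwise distinct nonzero proper ideals A = M1 × M2 × R3 × ⋯ × Rn, B = R1 × M2 × M3 × R4 × ⋯ × Rn, C = R1 × M2 × R3 × ⋯ × Rn, and D = M1 × R2 × M3 × R4 × ⋯ × Rn satisfy the adjacencies A ~ B, B ~ C, C ~ A, B ~ D, and D ~ A in the prime ideal sum graph PIS(R); that is, PIS(R) contains two triangles A–B–C and A–B–D sharing the common edge A–B. -/

import Mathlib

open IsLocalRing

/-- The ideal of the product ring `∀ i, Rs i` consisting of the functions whose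
`i`-th coordinate lies in `J` (and whose other coordinates are arbitrary), i.e. the
product ideal `R₁ × ⋯ × J × ⋯ × Rₙ`. -/
def coordIdeal {n : ℕ} (Rs : Fin n → Type*) [∀ i, CommRing (Rs i)]
    (i : Fin n) (J : Ideal (Rs i)) : Ideal (∀ i, Rs i) :=
  Ideal.comap (Pi.evalRingHom Rs i) J

section CoordIdeal

variable {n : ℕ} {Rs : Fin n → Type*} [∀ i, CommRing (Rs i)]

theorem mem_coordIdeal {i : Fin n} {J : Ideal (Rs i)} {x : ∀ i, Rs i} :
    x ∈ coordIdeal Rs i J ↔ x i ∈ J :=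
  Iff.rfl

theorem coordIdeal_isPrime (i : Fin n) (J : Ideal (Rs i)) [J.IsPrime] :
    (coordIdeal Rs i J).IsPrime :=
  Ideal.comap_isPrime (Pi.evalRingHom Rs i) J

theorem single_one_mem_coordIdeal_iff {i j : Fin n} {J : Ideal (Rs i)} (hJ : J ≠ ⊤) :
    Pi.single j 1 ∈ coordIdeal Rs i J ↔ j ≠ i := by
  rw [mem_coordIdeal]
  by_cases h : j = i
  · subst h
    simpa using (Ideal.ne_top_iff_one J).mp hJ
  · simp [h]

theorem coordIdeal_inf_sup_inf {i j k : Fin n} (hij : i ≠ j) (hjk : j ≠ k)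
    (I : Ideal (Rs i)) (J : Ideal (Rs j)) (K : Ideal (Rs k)) :
    coordIdeal Rs i I ⊓ coordIdeal Rs j J ⊔ coordIdeal Rs i I ⊓ coordIdeal Rs k K =
      coordIdeal Rs i I := by
  refine le_antisymm (sup_le inf_le_left inf_le_left) fun x hx => ?_
  rw [mem_coordIdeal] at hx
  rw [← sub_add_cancel x (Pi.single j (x j))]
  refine Submodule.add_mem_sup ⟨?_, ?_⟩ ⟨?_, ?_⟩ <;>
    simp only [SetLike.mem_coe, mem_coordIdeal, Pi.sub_apply]
  · simpa [Pi.single_eq_of_ne hij] using hx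
  · simp
  · simp [Pi.single_eq_of_ne hij]
  · simp [Pi.single_eq_of_ne hjk.symm]

end CoordIdeal

/-- For `R ≅ R₁ × ⋯ × Rₙ` (`n ≥ 3`) with each `Rᵢ` local, the four pairwise
distinct nonzero proper ideals `A = M₁ × M₂ × R₃ × ⋯ × Rₙ`,
`B = R₁ × M₂ × M₃ × R₄ × ⋯ × Rₙ`, `C = R₁ × M₂ × R₃ × ⋯ × Rₙ` and
`D = M₁ × R₂ × M₃ × R₄ × ⋯ × Rₙ` satisfy `A ~ B`, `B ~ C`, `C ~ A`, `B ~ D`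
and `D ~ A` in `PIS(R)`: two triangles `A–B–C` and `A–B–D` sharing the edge `A–B`. -/
theorem pis_two_triangles_common_edge_of_three_le
    (n : ℕ) (hn : 3 ≤ n) (Rs : Fin n → Type*)
    [∀ i, CommRing (Rs i)] [∀ i, IsLocalRing (Rs i)] :
    let A := coordIdeal Rs ⟨0, by omega⟩ (maximalIdeal _) ⊓
      coordIdeal Rs ⟨1, by omega⟩ (maximalIdeal _)
    let B := coordIdeal Rs ⟨1, by omega⟩ (maximalIdeal _) ⊓
      coordIdeal Rs ⟨2, by omega⟩ (maximalIdeal _)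
    let C := coordIdeal Rs ⟨1, by omega⟩ (maximalIdeal _)
    let D := coordIdeal Rs ⟨0, by omega⟩ (maximalIdeal _) ⊓
      coordIdeal Rs ⟨2, by omega⟩ (maximalIdeal _)
    (A ≠ ⊥ ∧ A ≠ ⊤) ∧ (B ≠ ⊥ ∧ B ≠ ⊤) ∧ (C ≠ ⊥ ∧ C ≠ ⊤) ∧ (D ≠ ⊥ ∧ D ≠ ⊤) ∧
    (A ≠ B ∧ A ≠ C ∧ A ≠ D ∧ B ≠ C ∧ B ≠ D ∧ C ≠ D) ∧
    (A ⊔ B).IsPrime ∧ (B ⊔ C).IsPrime ∧ (C ⊔ A).IsPrime ∧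
    (B ⊔ D).IsPrime ∧ (D ⊔ A).IsPrime := by
  intro A B C D
  have mem (i j : Fin n) : Pi.single j 1 ∈ coordIdeal Rs i (maximalIdeal (Rs i)) ↔ j ≠ i :=
    single_one_mem_coordIdeal_iff (Ideal.IsPrime.ne_top inferInstance)
  have ne_bot {I : Ideal (∀ i, Rs i)} (j : Fin n) (h : Pi.single j 1 ∈ I) : I ≠ ⊥ :=
    fun hI => by simp [hI] at h
  have ne_of_mem {I J : Ideal (∀ i, Rs i)} (j : Fin n)
      (h : ¬(Pi.single j 1 ∈ I ↔ Pi.single j 1 ∈ J)) : I ≠ J :=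
    fun hIJ => h (by rw [hIJ])
  have prime (i : Fin n) : (coordIdeal Rs i (maximalIdeal (Rs i))).IsPrime :=
    coordIdeal_isPrime i _
  let i₀ : Fin n := ⟨0, by omega⟩
  let i₁ : Fin n := ⟨1, by omega⟩
  let i₂ : Fin n := ⟨2, by omega⟩
  have h₀₁ : i₀ ≠ i₁ := by simp [i₀, i₁]
  have h₀₂ : i₀ ≠ i₂ := by simp [i₀, i₂]
  have h₁₂ : i₁ ≠ i₂ := by simp [i₁, i₂]
  have hAB : A ⊔ B = C := by
    rw [show A = C ⊓ coordIdeal Rs i₀ (maximalIdeal _) from inf_comm _ _]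
    exact coordIdeal_inf_sup_inf h₀₁.symm h₀₂ _ _ _
  have hBD : B ⊔ D = coordIdeal Rs i₂ (maximalIdeal _) := by
    rw [show B = coordIdeal Rs i₂ (maximalIdeal _) ⊓ coordIdeal Rs i₁ (maximalIdeal _)
        from inf_comm _ _,
      show D = coordIdeal Rs i₂ (maximalIdeal _) ⊓ coordIdeal Rs i₀ (maximalIdeal _)
        from inf_comm _ _]
    exact coordIdeal_inf_sup_inf h₁₂.symm h₀₁.symm _ _ _
  have hDA : D ⊔ A = coordIdeal Rs i₀ (maximalIdeal _) :=
    coordIdeal_inf_sup_inf h₀₂ h₁₂.symm _ _ _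
  have hBC : B ⊔ C = C := sup_eq_right.mpr inf_le_left
  have hCA : C ⊔ A = C := sup_eq_left.mpr inf_le_right
  rw [hAB, hBC, hCA, hBD, hDA]
  refine ⟨⟨ne_bot i₂ ?_, ne_of_mem i₁ ?_⟩, ⟨ne_bot i₀ ?_, ne_of_mem i₁ ?_⟩,
    ⟨ne_bot i₀ ?_, ne_of_mem i₁ ?_⟩, ⟨ne_bot i₁ ?_, ne_of_mem i₀ ?_⟩,
    ⟨ne_of_mem i₀ ?_, ne_of_mem i₀ ?_, ne_of_mem i₁ ?_, ne_of_mem i₂ ?_, ne_of_mem i₀ ?_,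
      ne_of_mem i₁ ?_⟩,
    prime _, prime _, prime _, prime _, prime _⟩ <;>
    simp [A, B, C, D, mem, i₀, i₁, i₂]
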